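/- arXiv:1806.03801 — 6 statements merged into one kernel-verified Lean document; each statement's English description precedes it below -/
import Mathlib

section
/- Let ψ: ℝ×ℝ → ℝ be continuously differentiable, let x = (x_1,…,x_N) ∈ ℝ^N, and let T be a continuously differentiable real-valued function defined on a neighborhood of x satisfying Σ_{n=1}^N ψ(y_n, T(y)) = 0 for every y in that neighborhood, with D := Σ_{n=1}^N ∂_θψ(x_n, T(x)) ≠ 0. Then the limit lim_{η→0+} (1/η)·sup{ |T(x+Δ) − T(x)| : Δ ∈ ℝ^N, (1/N)Σ_{n=1}^N |Δ_n| ≤ η } exists and equals N·max_{1≤n≤N} |∂_xψ(x_n, T(x))| / |D|. -/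
open Filter Topology

/-- A linear functional is bounded on the `ℓ₁` ball by its largest coefficient. -/
theorem abs_apply_le_iSup_mul_sum_abs {ι : Type*} [Fintype ι] [DecidableEq ι]
    (L : (ι → ℝ) →L[ℝ] ℝ) (v : ι → ℝ) :
    |L v| ≤ (⨆ i, |L (Pi.single i 1)|) * ∑ i, |v i| := by
  have hv : L v = ∑ i, v i * L (Pi.single i 1) := by
    conv_lhs => rw [pi_eq_sum_univ' v]
    rw [map_sum]
    refine Finset.sum_congr rfl fun i _ => ?_
    rw [map_smul, smul_eq_mul]
  rw [hv, Finset.mul_sum]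
  refine (Finset.abs_sum_le_sum_abs _ _).trans (Finset.sum_le_sum fun i _ => ?_)
  rw [abs_mul, mul_comm]
  gcongr
  exact le_ciSup (f := fun i => |L (Pi.single i 1)|) (Set.finite_range _).bddAbove i

/-- The normalized worst-case change of a differentiable function over shrinking `ℓ₁` balls
converges to the largest partial derivative. -/
theorem tendsto_sSup_abs_sub_div_of_hasFDerivAt {N : ℕ} (hN : 0 < N) {F : (Fin N → ℝ) → ℝ}
    {x : Fin N → ℝ} {L : (Fin N → ℝ) →L[ℝ] ℝ} (hF : HasFDerivAt F L x) :
    Tendsto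
      (fun η : ℝ => (1 / η) *
        sSup {r : ℝ | ∃ Δ : Fin N → ℝ,
          (1 / (N : ℝ)) * ∑ n, |Δ n| ≤ η ∧ r = |F (x + Δ) - F x|})
      (𝓝[>] (0 : ℝ)) (𝓝 ((N : ℝ) * ⨆ n : Fin N, |L (Pi.single n 1)|)) := by
  have hN' : (0 : ℝ) < N := by exact_mod_cast hN
  have : Nonempty (Fin N) := ⟨⟨0, hN⟩⟩
  set M := ⨆ n : Fin N, |L (Pi.single n 1)| with hM
  obtain ⟨k, hk⟩ := exists_eq_ciSup_of_finite (f := fun n : Fin N => |L (Pi.single n 1)|)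
  rw [← hM] at hk
  rw [Metric.tendsto_nhds]
  intro ε hε
  set c := ε / (2 * N) with hc
  have hcpos : 0 < c := by positivity
  have hcN : c * N = ε / 2 := by rw [hc]; field_simp
  have hlit := (hasFDerivAt_iff_isLittleO_nhds_zero.mp hF).bound hcpos
  obtain ⟨δ, hδ, hball⟩ := Metric.eventually_nhds_iff.mp hlit
  have hsmall : ∀ᶠ η : ℝ in 𝓝[>] 0, η < δ / N :=
    nhdsWithin_le_nhds (Iio_mem_nhds (by positivity))
  filter_upwards [hsmall, self_mem_nhdsWithin] with η hη hη0
  have hη0 : 0 < η := hη0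
  rw [lt_div_iff₀ hN'] at hη
  have key : ∀ Δ : Fin N → ℝ, (1 / (N : ℝ)) * ∑ n, |Δ n| ≤ η →
      ∑ n, |Δ n| ≤ η * N ∧ |F (x + Δ) - F x - L Δ| ≤ c * (η * N) := by
    intro Δ hΔ
    have h1 : ∑ n, |Δ n| ≤ η * N := by
      rwa [one_div, inv_mul_le_iff₀ hN', mul_comm] at hΔ
    have h2 : ‖Δ‖ ≤ η * N := by
      refine (pi_norm_le_iff_of_nonneg (by positivity)).mpr fun i => ?_
      exact (Finset.single_le_sum (f := fun n => |Δ n|) (fun _ _ => abs_nonneg _)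
        (Finset.mem_univ i)).trans h1
    refine ⟨h1, ?_⟩
    have h3 := hball (y := Δ) (by rw [dist_zero_right]; linarith)
    rw [Real.norm_eq_abs] at h3
    exact h3.trans (by gcongr)
  have hM0 : 0 ≤ M := hk ▸ abs_nonneg _
  set S := {r : ℝ | ∃ Δ : Fin N → ℝ,
    (1 / (N : ℝ)) * ∑ n, |Δ n| ≤ η ∧ r = |F (x + Δ) - F x|} with hS
  have hub : ∀ r ∈ S, r ≤ (M + c) * (η * N) := by
    rintro r ⟨Δ, hΔ, rfl⟩
    obtain ⟨h1, h2⟩ := key Δ hΔ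
    have h3 : |L Δ| ≤ M * (η * N) :=
      (abs_apply_le_iSup_mul_sum_abs L Δ).trans (by gcongr)
    have h4 := abs_add_le (F (x + Δ) - F x - L Δ) (L Δ)
    rw [sub_add_cancel] at h4
    linarith
  have hmem : (1 / (N : ℝ)) * ∑ n, |((η * N) • (Pi.single k 1 : Fin N → ℝ)) n| ≤ η := by
    have : ∑ n, |((η * N) • (Pi.single k 1 : Fin N → ℝ)) n| = η * N := by
      rw [Finset.sum_eq_single k]
      · simp [abs_of_pos hη0]
      · intro b _ hb
        simp [hb]
      · simp
    rw [this]
    field_simp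
    exact le_rfl
  have hlow : (M - c) * (η * N) ≤ sSup S := by
    refine le_csSup_of_le ⟨_, hub⟩ ⟨_, hmem, rfl⟩ ?_
    have h2 := (key _ hmem).2
    have h5 : |L ((η * N) • (Pi.single k 1 : Fin N → ℝ))| = M * (η * N) := by
      rw [map_smul, smul_eq_mul, abs_mul, hk, abs_of_pos (by positivity), mul_comm]
    have h4 := abs_sub_abs_le_abs_sub (L ((η * N) • (Pi.single k 1 : Fin N → ℝ)))
      (F (x + (η * N) • (Pi.single k 1 : Fin N → ℝ)) - F x)
    rw [abs_sub_comm (L _)] at h4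
    linarith
  have hup : sSup S ≤ (M + c) * (η * N) := csSup_le ⟨_, _, hmem, rfl⟩ hub
  have hl : (M - c) * N ≤ 1 / η * sSup S := by
    rw [one_div, le_inv_mul_iff₀ hη0]; linarith
  have hu : 1 / η * sSup S ≤ (M + c) * N := by
    rw [one_div, inv_mul_le_iff₀ hη0]; linarith
  rw [Real.dist_eq, abs_lt]
  constructor <;> linarith

/-- Implicit differentiation of the estimating equation `∑ n, ψ (y n) (T y) = 0`. -/
theorem implicit_deriv_of_sum_eq_zero {ι : Type*} [Fintype ι] [DecidableEq ι] {ψ : ℝ → ℝ → ℝ}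
    (hψ : Differentiable ℝ (Function.uncurry ψ)) {x : ι → ℝ} {T : (ι → ℝ) → ℝ}
    {L : (ι → ℝ) →L[ℝ] ℝ} (hT : HasFDerivAt T L x)
    (hEq : ∀ᶠ y in 𝓝 x, ∑ n, ψ (y n) (T y) = 0) (k : ι) :
    deriv (fun s => ψ s (T x)) (x k) +
      L (Pi.single k 1) * ∑ n, deriv (fun t => ψ (x n) t) (T x) = 0 := by
  have hP : ∀ n, HasFDerivAt (Function.uncurry ψ)
      (fderiv ℝ (Function.uncurry ψ) (x n, T x)) (x n, T x) := fun n => (hψ _).hasFDerivAt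
  have hx : ∀ n, deriv (fun s => ψ s (T x)) (x n) =
      fderiv ℝ (Function.uncurry ψ) (x n, T x) (1, 0) := fun n =>
    (HasFDerivAt.comp_hasDerivAt (f := fun s => (s, T x)) (x n) (hP n)
      ((hasDerivAt_id (x n)).prodMk (hasDerivAt_const (x n) (T x)))).deriv
  have ht : ∀ n, deriv (fun t => ψ (x n) t) (T x) =
      fderiv ℝ (Function.uncurry ψ) (x n, T x) (0, 1) := fun n =>
    (HasFDerivAt.comp_hasDerivAt (f := fun t => (x n, t)) (T x) (hP n)
      ((hasDerivAt_const (T x) (x n)).prodMk (hasDerivAt_id (T x)))).deriv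
  have hsum : HasFDerivAt (fun y : ι → ℝ => ∑ n, ψ (y n) (T y))
      (∑ n, (fderiv ℝ (Function.uncurry ψ) (x n, T x)).comp
        ((ContinuousLinearMap.proj (R := ℝ) (φ := fun _ : ι => ℝ) n).prod L)) x := by
    refine HasFDerivAt.fun_sum fun n _ => ?_
    exact HasFDerivAt.comp (g := Function.uncurry ψ) (f := fun y : ι → ℝ => (y n, T y)) x (hP n)
      ((hasFDerivAt_apply n x).prodMk hT)
  have hzero : HasFDerivAt (fun y : ι → ℝ => ∑ n, ψ (y n) (T y)) (0 : (ι → ℝ) →L[ℝ] ℝ) x :=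
    (hasFDerivAt_const (0 : ℝ) x).congr_of_eventuallyEq hEq
  have happ := congrArg (fun A : (ι → ℝ) →L[ℝ] ℝ => A (Pi.single k 1)) (hsum.unique hzero)
  have hsplit : ∀ n (a b : ℝ), fderiv ℝ (Function.uncurry ψ) (x n, T x) (a, b) =
      a * fderiv ℝ (Function.uncurry ψ) (x n, T x) (1, 0) +
        b * fderiv ℝ (Function.uncurry ψ) (x n, T x) (0, 1) := by
    intro n a b
    rw [← smul_eq_mul, ← smul_eq_mul, ← map_smul, ← map_smul, ← map_add]
    simp
  simp only [sum_apply, ContinuousLinearMap.comp_apply,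
    ContinuousLinearMap.prod_apply, ContinuousLinearMap.proj_apply,
    zero_apply] at happ
  simp_rw [hsplit _ _ (L _), ← hx, ← ht] at happ
  rw [Finset.sum_add_distrib, ← Finset.mul_sum] at happ
  simpa [Pi.single_apply] using happ

/-- AIF of an M-estimator under the ℓ₁ constraint. -/
theorem stmt_0 (N : ℕ) (hN : 0 < N) (ψ : ℝ → ℝ → ℝ)
    (hψ : ContDiff ℝ 1 (Function.uncurry ψ))
    (x : Fin N → ℝ) (T : (Fin N → ℝ) → ℝ) (U : Set (Fin N → ℝ))
    (hU : U ∈ 𝓝 x) (hT : ContDiffOn ℝ 1 T U)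
    (hEq : ∀ y ∈ U, ∑ n, ψ (y n) (T y) = 0)
    (hD : (∑ n, deriv (fun t => ψ (x n) t) (T x)) ≠ 0) :
    Tendsto
      (fun η : ℝ => (1 / η) *
        sSup {r : ℝ | ∃ Δ : Fin N → ℝ,
          (1 / (N : ℝ)) * ∑ n, |Δ n| ≤ η ∧ r = |T (x + Δ) - T x|})
      (𝓝[>] (0 : ℝ))
      (𝓝 ((N : ℝ) * (⨆ n : Fin N, |deriv (fun s => ψ s (T x)) (x n)|) /
        |∑ n, deriv (fun t => ψ (x n) t) (T x)|)) := by
  have hL : HasFDerivAt T (fderiv ℝ T x) x :=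
    ((hT.contDiffAt hU).differentiableAt one_ne_zero).hasFDerivAt
  have himp := implicit_deriv_of_sum_eq_zero (hψ.differentiable one_ne_zero) hL
    (eventually_of_mem hU hEq)
  convert tendsto_sSup_abs_sub_div_of_hasFDerivAt hN hL using 2
  rw [mul_div_assoc, div_eq_mul_inv, Real.iSup_mul_of_nonneg (by positivity)]
  congr 2
  ext k
  rw [← div_eq_mul_inv, div_eq_iff (abs_ne_zero.mpr hD), ← abs_mul,
    eq_neg_of_add_eq_zero_left (himp k), abs_neg]
end

section
/- Let p > 1 be real. Let ψ: ℝ×ℝ → ℝ be continuously differentiable, let x = (x_1,…,x_N) ∈ ℝ^N, and let T be a continuously differentiable real-valued function defined on a neighborhood of x satisfying Σ_{n=1}^N ψ(y_n, T(y)) = 0 for every y in that neighborhood, with Σ_{n=1}^N ∂_θψ(x_n, T(x)) ≠ 0. Then the limit lim_{η→0+} (1/η)·sup{ |T(x+Δ) − T(x)| : Δ ∈ ℝ^N, (1/N)Σ_{n=1}^N |Δ_n|^p ≤ η^p } exists and equals ((1/N)Σ_{n=1}^N |∂_xψ(x_n, T(x))|^{p/(p−1)})^{(p−1)/p} / |(1/N)Σ_{n=1}^N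 ∂_θψ(x_n, T(x))|. -/
open Filter Topology

/-- If `f` has derivative `L` at `x` and `M` is the maximum of `|L|` on a bounded set `K`, then the
largest deviation of `f` from `f x` over the rescaled sets `η • K` is `η * M` to first order. -/
theorem tendsto_inv_mul_sSup_abs_sub {E : Type*} [NormedAddCommGroup E] [NormedSpace ℝ E]
    {f : E → ℝ} {L : E →L[ℝ] ℝ} {x : E} (hf : HasFDerivAt f L x) {K : Set E}
    (hK : Bornology.IsBounded K) {M : ℝ} (hM : IsGreatest ((fun v => |L v|) '' K) M) :
    Tendsto (fun η : ℝ => (1 / η) * sSup ((fun v => |f (x + η • v) - f x|) '' K))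
      (𝓝[>] 0) (𝓝 M) := by
  obtain ⟨C, hC0, hC⟩ := hK.exists_pos_norm_le
  rw [Metric.tendsto_nhds]
  intro ε hε
  have hsmall := (hasFDerivAt_iff_isLittleO_nhds_zero.1 hf).def
    (show 0 < ε / 2 / C by positivity)
  obtain ⟨δ, hδ, hball⟩ := Metric.eventually_nhds_iff.1 hsmall
  filter_upwards [Ioo_mem_nhdsGT (show (0 : ℝ) < δ / C by positivity)] with η hη
  obtain ⟨hη0, hηδ⟩ := hη
  have key : ∀ v ∈ K, |f (x + η • v) - f x - η * L v| ≤ ε / 2 * η := by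
    intro v hv
    have hn : ‖η • v‖ ≤ η * C := by
      rw [norm_smul, Real.norm_of_nonneg hη0.le]
      exact mul_le_mul_of_nonneg_left (hC v hv) hη0.le
    have h := hball (y := η • v) (by
      rw [dist_zero_right]
      exact hn.trans_lt ((lt_div_iff₀ hC0).1 hηδ))
    rw [map_smul, smul_eq_mul, Real.norm_eq_abs] at h
    calc _ ≤ ε / 2 / C * ‖η • v‖ := h
      _ ≤ ε / 2 / C * (η * C) := by gcongr
      _ = ε / 2 * η := by field_simp
  have hupper : ∀ r ∈ (fun v => |f (x + η • v) - f x|) '' K, r ≤ η * (M + ε / 2) := by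
    rintro _ ⟨v, hv, rfl⟩
    have h1 := key v hv
    have h2 : |L v| ≤ M := hM.2 ⟨v, hv, rfl⟩
    have h3 := abs_sub_abs_le_abs_sub (f (x + η • v) - f x) (η * L v)
    rw [abs_mul, abs_of_pos hη0] at h3
    have h4 := mul_le_mul_of_nonneg_left h2 hη0.le
    dsimp only
    linarith
  obtain ⟨w, hw, hwM⟩ := hM.1
  have hlower : η * (M - ε / 2) ≤ sSup ((fun v => |f (x + η • v) - f x|) '' K) := by
    refine le_trans ?_ (le_csSup ⟨_, hupper⟩ ⟨w, hw, rfl⟩)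
    have h1 := key w hw
    have h3 := abs_sub_abs_le_abs_sub (η * L w) (f (x + η • w) - f x)
    rw [abs_mul, abs_of_pos hη0, abs_sub_comm (η * L w)] at h3
    dsimp only at hwM ⊢
    rw [hwM] at h3
    linarith
  have hsup := csSup_le (Set.Nonempty.image _ ⟨w, hw⟩) hupper
  rw [Real.dist_eq, one_div_mul_eq_div]
  have h1 := (le_div_iff₀' hη0).2 hlower
  have h2 := (div_le_iff₀' hη0).2 hsup
  rw [abs_lt]
  constructor <;> linarith

/-- The extremal case of Hölder's inequality on the `ℓ_p` ball of radius `R ^ (1 / p)`. -/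
theorem isGreatest_abs_sum_mul {ι : Type*} [Fintype ι] {p q : ℝ} (hpq : p.HolderConjugate q)
    (a : ι → ℝ) {R : ℝ} (hR : 0 ≤ R) :
    IsGreatest ((fun v : ι → ℝ => |∑ i, a i * v i|) '' {v | ∑ i, |v i| ^ p ≤ R})
      (R ^ (1 / p) * (∑ i, |a i| ^ q) ^ (1 / q)) := by
  constructor
  · obtain ⟨g, hg, hag⟩ :=
      (NNReal.isGreatest_Lp Finset.univ (fun i => ‖a i‖₊) hpq.symm).1
    have hg' : ∑ i, (g i : ℝ) ^ p ≤ 1 := by exact_mod_cast hg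
    have hag' : ∑ i, |a i| * g i = (∑ i, |a i| ^ q) ^ (1 / q) := by
      simpa using congrArg NNReal.toReal hag
    refine ⟨fun i => R ^ (1 / p) * (SignType.sign (a i) * g i), ?_, ?_⟩
    · calc ∑ i, |R ^ (1 / p) * (SignType.sign (a i) * g i)| ^ p
          ≤ ∑ i, R * (g i : ℝ) ^ p := by
            refine Finset.sum_le_sum fun i _ => ?_
            have hs : |((SignType.sign (a i) : SignType) : ℝ)| ≤ 1 := by
              rcases SignType.sign (a i) with _ | _ | _ <;> simp
            rw [abs_mul, abs_mul, abs_of_nonneg (Real.rpow_nonneg hR _),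
              Real.mul_rpow (Real.rpow_nonneg hR _) (by positivity), ← Real.rpow_mul hR,
              one_div_mul_cancel hpq.ne_zero, Real.rpow_one, NNReal.abs_eq]
            refine mul_le_mul_of_nonneg_left (Real.rpow_le_rpow (by positivity) ?_ hpq.nonneg) hR
            exact mul_le_of_le_one_left (g i).coe_nonneg hs
        _ ≤ R := by
            rw [← Finset.mul_sum]
            exact mul_le_of_le_one_right hR hg'
    · have h : ∑ i, a i * (R ^ (1 / p) * (SignType.sign (a i) * g i))
          = R ^ (1 / p) * ∑ i, |a i| * g i := by
        rw [Finset.mul_sum]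
        refine Finset.sum_congr rfl fun i _ => ?_
        rw [← self_mul_sign (a i)]
        ring
      dsimp only
      rw [h, hag', abs_of_nonneg (by positivity)]
  · rintro _ ⟨v, hv, rfl⟩
    calc |∑ i, a i * v i| ≤ ∑ i, |v i| * |a i| := by
          refine (Finset.abs_sum_le_sum_abs _ _).trans_eq ?_
          exact Finset.sum_congr rfl fun i _ => by rw [abs_mul, mul_comm]
      _ ≤ (∑ i, |v i| ^ p) ^ (1 / p) * (∑ i, |a i| ^ q) ^ (1 / q) := by
          simpa using Real.inner_le_Lp_mul_Lq Finset.univ (fun i => |v i|) (fun i => |a i|) hpq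
      _ ≤ _ := by
          have := hpq.pos
          gcongr
          exact hv

theorem isBounded_setOf_sum_abs_rpow_le {ι : Type*} [Fintype ι] {p : ℝ} (hp : 0 < p) (R : ℝ) :
    Bornology.IsBounded {v : ι → ℝ | ∑ i, |v i| ^ p ≤ R} := by
  refine isBounded_iff_forall_norm_le.2 ⟨|R| ^ (1 / p), fun v hv => ?_⟩
  refine (pi_norm_le_iff_of_nonneg (by positivity)).2 fun i => ?_
  have h : |v i| ^ p ≤ |R| := (Finset.single_le_sum (f := fun i => |v i| ^ p)
    (fun i _ => by positivity) (Finset.mem_univ i)).trans (hv.trans (le_abs_self R))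
  rw [Real.norm_eq_abs, ← Real.rpow_rpow_inv (abs_nonneg (v i)) hp.ne', one_div]
  gcongr

/-- Implicit differentiation of the estimating equation `∑ i, ψ (y i) (T y) = 0`. -/
theorem fderiv_mEstimator_apply {ι : Type*} [Fintype ι] {ψ : ℝ → ℝ → ℝ} {x : ι → ℝ}
    {T : (ι → ℝ) → ℝ}
    (hψ : ∀ i, DifferentiableAt ℝ (Function.uncurry ψ) (x i, T x))
    (hT : DifferentiableAt ℝ T x) (hEq : ∀ᶠ y in 𝓝 x, ∑ i, ψ (y i) (T y) = 0)
    (hD : ∑ i, deriv (fun t => ψ (x i) t) (T x) ≠ 0) (v : ι → ℝ) :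
    fderiv ℝ T x v = -(∑ i, deriv (fun s => ψ s (T x)) (x i) * v i) /
      ∑ i, deriv (fun t => ψ (x i) t) (T x) := by
  have hpartial : ∀ i, ∀ s t : ℝ, fderiv ℝ (Function.uncurry ψ) (x i, T x) (s, t)
      = deriv (fun s => ψ s (T x)) (x i) * s + deriv (fun t => ψ (x i) t) (T x) * t := by
    intro i s t
    have h1 : HasDerivAt (fun s => ψ s (T x))
        (fderiv ℝ (Function.uncurry ψ) (x i, T x) (1, 0)) (x i) :=
      HasFDerivAt.comp_hasDerivAt (l := Function.uncurry ψ) (x i) (hψ i).hasFDerivAt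
        ((hasDerivAt_id (x i)).prodMk (hasDerivAt_const (x i) (T x)))
    have h2 : HasDerivAt (fun t => ψ (x i) t)
        (fderiv ℝ (Function.uncurry ψ) (x i, T x) (0, 1)) (T x) :=
      HasFDerivAt.comp_hasDerivAt (l := Function.uncurry ψ) (T x) (hψ i).hasFDerivAt
        ((hasDerivAt_const (T x) (x i)).prodMk (hasDerivAt_id (T x)))
    have h3 : ((s, t) : ℝ × ℝ) = s • ((1, 0) : ℝ × ℝ) + t • ((0, 1) : ℝ × ℝ) := by simp
    rw [h1.deriv, h2.deriv, h3, map_add, map_smul, map_smul, smul_eq_mul, smul_eq_mul]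
    ring
  have hsum : HasFDerivAt (fun y : ι → ℝ => ∑ i, ψ (y i) (T y))
      (∑ i, (fderiv ℝ (Function.uncurry ψ) (x i, T x)).comp
        ((ContinuousLinearMap.proj i).prod (fderiv ℝ T x))) x := by
    refine HasFDerivAt.fun_sum fun i _ => ?_
    exact HasFDerivAt.comp (g := Function.uncurry ψ) (f := fun y : ι → ℝ => (y i, T y)) x
      (hψ i).hasFDerivAt ((hasFDerivAt_apply i x).prodMk hT.hasFDerivAt)
  have hzero := congrArg (fun F => F v)
    (hsum.unique ((hasFDerivAt_const (0 : ℝ) x).congr_of_eventuallyEq hEq))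
  simp only [sum_apply, ContinuousLinearMap.comp_apply, ContinuousLinearMap.prod_apply,
    ContinuousLinearMap.proj_apply, hpartial, Finset.sum_add_distrib, ← Finset.sum_mul,
    zero_apply] at hzero
  rw [eq_div_iff hD]
  linarith

/-- AIF of an M-estimator under the ℓ_p constraint, p > 1. -/
theorem stmt_1 (N : ℕ) (hN : 0 < N) (p : ℝ) (hp : 1 < p) (ψ : ℝ → ℝ → ℝ)
    (hψ : ContDiff ℝ 1 (Function.uncurry ψ))
    (x : Fin N → ℝ) (T : (Fin N → ℝ) → ℝ) (U : Set (Fin N → ℝ))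
    (hU : U ∈ 𝓝 x) (hT : ContDiffOn ℝ 1 T U)
    (hEq : ∀ y ∈ U, ∑ n, ψ (y n) (T y) = 0)
    (hD : (∑ n, deriv (fun t => ψ (x n) t) (T x)) ≠ 0) :
    Tendsto
      (fun η : ℝ => (1 / η) *
        sSup {r : ℝ | ∃ Δ : Fin N → ℝ,
          (1 / (N : ℝ)) * ∑ n, |Δ n| ^ p ≤ η ^ p ∧ r = |T (x + Δ) - T x|})
      (𝓝[>] (0 : ℝ))
      (𝓝 (((1 / (N : ℝ)) * ∑ n, |deriv (fun s => ψ s (T x)) (x n)| ^ (p / (p - 1))) ^ ((p - 1) / p) /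
        |(1 / (N : ℝ)) * ∑ n, deriv (fun t => ψ (x n) t) (T x)|)) := by
  have hpq : p.HolderConjugate (p / (p - 1)) := Real.HolderConjugate.conjExponent hp
  have hN' : (0 : ℝ) < N := by exact_mod_cast hN
  have hTx : DifferentiableAt ℝ T x := (hT.contDiffAt hU).differentiableAt one_ne_zero
  have hL := fderiv_mEstimator_apply (fun i => (hψ.differentiable one_ne_zero).differentiableAt)
    hTx (eventually_of_mem hU hEq) hD
  set a : Fin N → ℝ := fun n => deriv (fun s => ψ s (T x)) (x n)
  set D : ℝ := ∑ n, deriv (fun t => ψ (x n) t) (T x)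
  have hmax : IsGreatest ((fun v => |fderiv ℝ T x v|) '' {v | ∑ n, |v n| ^ p ≤ (N : ℝ)})
      ((N : ℝ) ^ (1 / p) * (∑ n, |a n| ^ (p / (p - 1))) ^ (1 / (p / (p - 1))) / |D|) := by
    have h := (monotone_div_right_of_nonneg (abs_nonneg D)).map_isGreatest
      (isGreatest_abs_sum_mul hpq a hN'.le)
    rw [Set.image_image] at h
    simpa only [hL, abs_div, abs_neg] using h
  have hlim := tendsto_inv_mul_sSup_abs_sub hTx.hasFDerivAt
    (isBounded_setOf_sum_abs_rpow_le hpq.pos N) hmax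
  have hval : (N : ℝ) ^ (1 / p) * (∑ n, |a n| ^ (p / (p - 1))) ^ (1 / (p / (p - 1))) / |D|
      = (1 / (N : ℝ) * ∑ n, |a n| ^ (p / (p - 1))) ^ ((p - 1) / p) / |1 / (N : ℝ) * D| := by
    have hexp : (N : ℝ) ^ (1 / p) * (N : ℝ) ^ ((p - 1) / p) = N := by
      rw [← Real.rpow_add hN', ← add_div, add_sub_cancel, div_self hpq.ne_zero, Real.rpow_one]
    have hpos : (0 : ℝ) < (N : ℝ) ^ ((p - 1) / p) := by positivity
    have hD' : |D| ≠ 0 := abs_ne_zero.2 hD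
    rw [Real.mul_rpow (by positivity) (by positivity), Real.div_rpow zero_le_one hN'.le,
      Real.one_rpow, abs_mul, abs_of_pos (one_div_pos.2 hN'), one_div_div]
    field_simp
    linear_combination (∑ n, |a n| ^ (p / (p - 1))) ^ ((p - 1) / p) * hexp
  rw [← hval]
  refine hlim.congr' (eventually_mem_nhdsWithin.mono fun η hη => ?_)
  have hη0 : (0 : ℝ) < η := hη
  have hball : ∀ v : Fin N → ℝ, (1 / (N : ℝ)) * ∑ n, |(η • v) n| ^ p ≤ η ^ p ↔
      ∑ n, |v n| ^ p ≤ N := by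
    intro v
    have hηp : 0 < η ^ p := Real.rpow_pos_of_pos hη0 p
    simp only [Pi.smul_apply, smul_eq_mul, abs_mul, abs_of_pos hη0,
      Real.mul_rpow hη0.le (abs_nonneg _), ← Finset.mul_sum]
    rw [one_div_mul_eq_div, div_le_iff₀ hN', mul_le_mul_iff_right₀ hηp]
  congr 2
  ext r
  constructor
  · rintro ⟨v, hv, rfl⟩
    exact ⟨η • v, (hball v).2 hv, rfl⟩
  · rintro ⟨Δ, hΔ, rfl⟩
    have hΔη : η • η⁻¹ • Δ = Δ := smul_inv_smul₀ hη0.ne' Δ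
    exact ⟨η⁻¹ • Δ, (hball _).1 (by rwa [hΔη]), by simp only [hΔη]⟩
end

section
/- Let f₀ be a probability density on ℝ with cumulative distribution function F₀, and let ξ > 0. Suppose ν* ∈ ℝ and ϑ₁*, ϑ₂* ≥ 0, and define g*(x) = ν* − (ϑ₂* + (ϑ₁* − ϑ₂*)F₀(x))/f₀(x) when f₀(x) > 0 and ν*·f₀(x) > ϑ₂* + (ϑ₁* − ϑ₂*)F₀(x), and g*(x) = 0 otherwise. Assume g* satisfies: ∫ g*(x) f₀(x) dx = 1; ∫ g*(x) F₀(x) dx ≤ ξ with ϑ₁*·(∫ g*(x) F₀(x) dx − ξ) = 0; and ∫ g*(x)(1 − F₀(x)) dx ≤ ξ with ϑ₂*·(∫ g*(x)(1 − F₀(x)) dx − ξ) = 0. Then for every measurable g: ℝ → [0,∞) satisfying ∫ g f₀ dx = 1, ∫ g F₀ dx ≤ ξ and ∫ g(1 − F₀) dx ≤ ξ, one has ∫ g*(x)² f₀(x) dx ≤ ∫ g(x)² f₀(x) dx. -/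
open MeasureTheory

/-- The pointwise form of the KKT inequality, with the multipliers `ϑ1`, `ϑ2` split into the two
one-sided constraints so that every term is nonnegative. -/
lemma kkt_pointwise {f F ν ϑ1 ϑ2 s g : ℝ} (hf : 0 ≤ f) (hF0 : 0 ≤ F) (hF1 : F ≤ 1)
    (hϑ1 : 0 ≤ ϑ1) (hϑ2 : 0 ≤ ϑ2) (hg : 0 ≤ g)
    (hs : s = if 0 < f ∧ ϑ2 + (ϑ1 - ϑ2) * F < ν * f
      then ν - (ϑ2 + (ϑ1 - ϑ2) * F) / f else 0) :
    s ^ 2 * f + (2 * ν * (g * f) + (2 * ϑ1 * (s * F) + 2 * ϑ2 * (s * (1 - F)))) ≤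
      g ^ 2 * f + (2 * ν * (s * f) + (2 * ϑ1 * (g * F) + 2 * ϑ2 * (g * (1 - F)))) := by
  have hc : 0 ≤ ϑ2 + (ϑ1 - ϑ2) * F := by
    nlinarith [mul_nonneg hϑ1 hF0, mul_nonneg hϑ2 (sub_nonneg.2 hF1)]
  have hstat : 0 ≤ (g - s) * (s * f + (ϑ2 + (ϑ1 - ϑ2) * F) - ν * f) := by
    split_ifs at hs with h
    · have hsf : s * f = ν * f - (ϑ2 + (ϑ1 - ϑ2) * F) := by
        rw [hs, sub_mul, div_mul_cancel₀ _ h.1.ne']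
      simp [hsf]
    · have hle : ν * f ≤ ϑ2 + (ϑ1 - ϑ2) * F := by
        rcases hf.eq_or_lt with h0 | h0
        · simpa [← h0] using hc
        · exact not_lt.1 fun h1 => h ⟨h0, h1⟩
      simpa [hs] using mul_nonneg hg (sub_nonneg.2 hle)
  nlinarith [mul_nonneg (sq_nonneg (g - s)) hf]

/-- Complementary slackness makes the optimal constraint value dominate any feasible one, once
weighted by the multiplier. -/
lemma slackness_mul_le {ϑ ξ : ℝ} (hξ : 0 < ξ) {I J : ENNReal}
    (hslack : ϑ * (J.toReal - ξ) = 0) (hI : I ≤ ENNReal.ofReal ξ) :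
    ENNReal.ofReal (2 * ϑ) * I ≤ ENNReal.ofReal (2 * ϑ) * J := by
  rcases mul_eq_zero.1 hslack with h | h
  · simp [h]
  · rw [← sub_eq_zero.1 h] at hI hξ
    rw [ENNReal.ofReal_toReal (ENNReal.toReal_pos_iff.1 hξ).2.ne] at hI
    gcongr

/-- Theorem 2 of the paper: KKT sufficiency for the location-estimator
score derivative minimizing the ℓ₂ AIF subject to a gross-error-sensitivity bound. -/
theorem stmt_12 (f0 F0 : ℝ → ℝ) (hf0meas : Measurable f0) (hf0pos : ∀ x, 0 ≤ f0 x)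
    (hf0int : ∫⁻ x, ENNReal.ofReal (f0 x) = 1)
    (hF0 : ∀ x, F0 x = (∫⁻ t in Set.Iic x, ENNReal.ofReal (f0 t)).toReal)
    (ξ : ℝ) (hξ : 0 < ξ)
    (ν ϑ1 ϑ2 : ℝ) (hϑ1 : 0 ≤ ϑ1) (hϑ2 : 0 ≤ ϑ2)
    (gstar : ℝ → ℝ)
    (hgstar : ∀ x, gstar x =
      if 0 < f0 x ∧ ϑ2 + (ϑ1 - ϑ2) * F0 x < ν * f0 x
      then ν - (ϑ2 + (ϑ1 - ϑ2) * F0 x) / f0 x else 0)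
    (hnorm : ∫⁻ x, ENNReal.ofReal (gstar x * f0 x) = 1)
    (hc1 : ∫⁻ x, ENNReal.ofReal (gstar x * F0 x) ≤ ENNReal.ofReal ξ)
    (hs1 : ϑ1 * ((∫⁻ x, ENNReal.ofReal (gstar x * F0 x)).toReal - ξ) = 0)
    (hc2 : ∫⁻ x, ENNReal.ofReal (gstar x * (1 - F0 x)) ≤ ENNReal.ofReal ξ)
    (hs2 : ϑ2 * ((∫⁻ x, ENNReal.ofReal (gstar x * (1 - F0 x))).toReal - ξ) = 0) :
    ∀ g : ℝ → ℝ, Measurable g → (∀ x, 0 ≤ g x) →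
      (∫⁻ x, ENNReal.ofReal (g x * f0 x)) = 1 →
      (∫⁻ x, ENNReal.ofReal (g x * F0 x)) ≤ ENNReal.ofReal ξ →
      (∫⁻ x, ENNReal.ofReal (g x * (1 - F0 x))) ≤ ENNReal.ofReal ξ →
      (∫⁻ x, ENNReal.ofReal (gstar x ^ 2 * f0 x)) ≤ ∫⁻ x, ENNReal.ofReal (g x ^ 2 * f0 x) := by
  intro g hgm hg hgn hg1 hg2
  have hF0nonneg : ∀ x, 0 ≤ F0 x := fun x => by rw [hF0]; exact ENNReal.toReal_nonneg
  have hle : ∀ x, ∫⁻ t in Set.Iic x, ENNReal.ofReal (f0 t) ≤ 1 := fun x =>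
    hf0int ▸ setLIntegral_le_lintegral _ _
  have hF0le : ∀ x, F0 x ≤ 1 := fun x => by
    rw [hF0]; exact ENNReal.toReal_mono ENNReal.one_ne_top (hle x)
  have hF0mono : Monotone F0 := fun x y hxy => by
    rw [hF0, hF0]
    exact ENNReal.toReal_mono ((hle y).trans_lt ENNReal.one_lt_top).ne
      (lintegral_mono_set (Set.Iic_subset_Iic.2 hxy))
  have hF0m : Measurable F0 := hF0mono.measurable
  have hsm : Measurable gstar := by
    rw [funext hgstar]
    refine Measurable.ite ?_ (by fun_prop) measurable_const
    exact (measurableSet_lt measurable_const hf0meas).inter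
      (measurableSet_lt ((hF0m.const_mul _).const_add _) (hf0meas.const_mul _))
  have hs : ∀ x, 0 ≤ gstar x := fun x => by
    rw [hgstar]
    split_ifs with h
    · exact sub_nonneg.2 ((div_le_iff₀ h.1).2 h.2.le)
    · exact le_rfl
  have hc : ∀ x, 0 ≤ ϑ2 + (ϑ1 - ϑ2) * F0 x := fun x => by
    nlinarith [mul_nonneg hϑ1 (hF0nonneg x), mul_nonneg hϑ2 (sub_nonneg.2 (hF0le x))]
  have hν : 0 ≤ ν := by
    by_contra! hneg
    have hzero : ∀ x, gstar x = 0 := fun x => by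
      rw [hgstar, if_neg]
      rintro ⟨h0, h1⟩
      nlinarith [hc x, mul_pos (neg_pos.2 hneg) h0]
    simp [hzero] at hnorm
  have hpt : ∀ x, ENNReal.ofReal (gstar x ^ 2 * f0 x) +
      (ENNReal.ofReal (2 * ν) * ENNReal.ofReal (g x * f0 x) +
        (ENNReal.ofReal (2 * ϑ1) * ENNReal.ofReal (gstar x * F0 x) +
          ENNReal.ofReal (2 * ϑ2) * ENNReal.ofReal (gstar x * (1 - F0 x)))) ≤
      ENNReal.ofReal (g x ^ 2 * f0 x) +
      (ENNReal.ofReal (2 * ν) * ENNReal.ofReal (gstar x * f0 x) +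
        (ENNReal.ofReal (2 * ϑ1) * ENNReal.ofReal (g x * F0 x) +
          ENNReal.ofReal (2 * ϑ2) * ENNReal.ofReal (g x * (1 - F0 x)))) := fun x => by
    have hf := hf0pos x
    have hF := hF0nonneg x
    have hF' := sub_nonneg.2 (hF0le x)
    have hgx := hg x
    have hsx := hs x
    rw [← ENNReal.ofReal_mul (by positivity), ← ENNReal.ofReal_mul (by positivity),
      ← ENNReal.ofReal_mul (by positivity), ← ENNReal.ofReal_mul (by positivity),
      ← ENNReal.ofReal_mul (by positivity), ← ENNReal.ofReal_mul (by positivity),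
      ← ENNReal.ofReal_add (by positivity) (by positivity),
      ← ENNReal.ofReal_add (by positivity) (by positivity),
      ← ENNReal.ofReal_add (by positivity) (by positivity),
      ← ENNReal.ofReal_add (by positivity) (by positivity),
      ← ENNReal.ofReal_add (by positivity) (by positivity),
      ← ENNReal.ofReal_add (by positivity) (by positivity)]
    exact ENNReal.ofReal_le_ofReal
      (kkt_pointwise hf hF (hF0le x) hϑ1 hϑ2 hgx (hgstar x))
  have hint := lintegral_mono (μ := volume) hpt
  rw [lintegral_add_left (by fun_prop), lintegral_add_left (by fun_prop),
    lintegral_add_left (by fun_prop), lintegral_add_left (by fun_prop),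
    lintegral_add_left (by fun_prop), lintegral_add_left (by fun_prop),
    lintegral_const_mul _ (by fun_prop), lintegral_const_mul _ (by fun_prop),
    lintegral_const_mul _ (by fun_prop), lintegral_const_mul _ (by fun_prop),
    lintegral_const_mul _ (by fun_prop), lintegral_const_mul _ (by fun_prop),
    hgn, hnorm] at hint
  have hfin1 := (hc1.trans_lt ENNReal.ofReal_lt_top).ne
  have hfin2 := (hc2.trans_lt ENNReal.ofReal_lt_top).ne
  refine (ENNReal.add_le_add_iff_right ?_).1 (hint.trans (add_le_add_right
    (add_le_add_right (add_le_add (slackness_mul_le hξ hs1 hg1)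
      (slackness_mul_le hξ hs2 hg2)) _) _))
  finiteness
end

section
/- Let f₁ be a probability density on ℝ with cumulative distribution function F₁, and let ξ > 0. Suppose ν* ∈ ℝ and ϑ₁*, ϑ₂* ≥ 0, and define g*(x) = ν*·x − (ϑ₂* + (ϑ₁* − ϑ₂*)F₁(x))/f₁(x) when f₁(x) > 0 and ν*·x·f₁(x) > ϑ₂* + (ϑ₁* − ϑ₂*)F₁(x), and g*(x) = 0 otherwise. Assume g* satisfies: ∫ x·g*(x) f₁(x) dx = 1; ∫ g*(x) F₁(x) dx ≤ ξ with ϑ₁*·(∫ g*(x) F₁(x) dx − ξ) = 0; and ∫ g*(x)(1 − F₁(x)) dx ≤ ξ with ϑ₂*·(∫ g*(x)(1 − F₁(x)) dx − ξ) = 0. Then for every measurable g: ℝ → [0,∞) satisfying ∫ x·g(x) f₁(x) dx = 1, ∫ g F₁ dx ≤ ξ and ∫ g(1 − F₁) dx ≤ ξ, one has ∫ g*(x)² f₁(x) dx ≤ ∫ g(x)² f₁(x) dx. -/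
open MeasureTheory

/-- A nonnegative measurable function with lower integral at most `ofReal c` is integrable, with
integral at most `c`. -/
theorem integrable_and_integral_le_of_lintegral_ofReal_le {α : Type*} [MeasurableSpace α]
    {μ : Measure α} {h : α → ℝ} (hm : Measurable h) (h0 : ∀ x, 0 ≤ h x) {c : ℝ} (hc : 0 ≤ c)
    (hle : ∫⁻ x, ENNReal.ofReal (h x) ∂μ ≤ ENNReal.ofReal c) :
    Integrable h μ ∧ ∫ x, h x ∂μ = (∫⁻ x, ENNReal.ofReal (h x) ∂μ).toReal ∧ ∫ x, h x ∂μ ≤ c := by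
  have he : ∫ x, h x ∂μ = (∫⁻ x, ENNReal.ofReal (h x) ∂μ).toReal :=
    integral_eq_lintegral_of_nonneg_ae (.of_forall h0) hm.aestronglyMeasurable
  refine ⟨?_, he, he ▸ ENNReal.toReal_le_of_le_ofReal hc hle⟩
  rw [← lintegral_ofReal_ne_top_iff_integrable hm.aestronglyMeasurable (.of_forall h0)]
  exact (hle.trans_lt ENNReal.ofReal_lt_top).ne

/-- Scalar inequality behind the sufficiency of the KKT conditions: the tangent-line bound at the
truncated score `s`, where `f` is the density, `a` the linear term and `w` the multiplier term. -/
theorem truncated_score_tangent_le {f w a s g : ℝ} (hf : 0 ≤ f) (hw : 0 ≤ w) (hg : 0 ≤ g)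
    (hs : s = if 0 < f ∧ w < a * f then a - w / f else 0) :
    s ^ 2 * f + 2 * ((a * f - w) * (g - s)) ≤ g ^ 2 * f := by
  split_ifs at hs with h
  · have hsf : a * f - w = s * f := by
      have := h.1.ne'
      rw [hs]; field_simp
    rw [hsf]
    nlinarith [mul_nonneg hf (sq_nonneg (g - s))]
  · subst hs
    have haf : a * f - w ≤ 0 := by
      rcases hf.eq_or_lt with rfl | hf
      · simpa using hw
      · exact sub_nonpos.2 (not_lt.1 fun h' => h ⟨hf, h'⟩)
    nlinarith [mul_nonneg hf (sq_nonneg g), mul_nonneg (neg_nonneg.2 haf) hg]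

theorem truncated_score_nonneg {f w a s : ℝ}
    (hs : s = if 0 < f ∧ w < a * f then a - w / f else 0) : 0 ≤ s := by
  split_ifs at hs with h
  · rw [hs, sub_nonneg, div_le_iff₀ h.1]
    exact h.2.le
  · exact hs.ge

theorem truncated_score_sq_mul {f w a s : ℝ}
    (hs : s = if 0 < f ∧ w < a * f then a - w / f else 0) : s ^ 2 * f = s * (a * f - w) := by
  split_ifs at hs with h
  · have := h.1.ne'
    rw [hs]; field_simp
  · simp [hs]

/-- Theorem 4 of the paper: KKT sufficiency for the scale-estimator
score derivative minimizing the ℓ₂ AIF subject to a gross-error-sensitivity bound. -/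
theorem stmt_13 (f1 F1 : ℝ → ℝ) (hf1meas : Measurable f1) (hf1pos : ∀ x, 0 ≤ f1 x)
    (hf1int : ∫⁻ x, ENNReal.ofReal (f1 x) = 1)
    (hF1 : ∀ x, F1 x = (∫⁻ t in Set.Iic x, ENNReal.ofReal (f1 t)).toReal)
    (ξ : ℝ) (hξ : 0 < ξ)
    (ν ϑ1 ϑ2 : ℝ) (hϑ1 : 0 ≤ ϑ1) (hϑ2 : 0 ≤ ϑ2)
    (gstar : ℝ → ℝ)
    (hgstar : ∀ x, gstar x =
      if 0 < f1 x ∧ ϑ2 + (ϑ1 - ϑ2) * F1 x < ν * x * f1 x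
      then ν * x - (ϑ2 + (ϑ1 - ϑ2) * F1 x) / f1 x else 0)
    (hnormint : Integrable (fun x => x * gstar x * f1 x))
    (hnorm : ∫ x, x * gstar x * f1 x = 1)
    (hc1 : ∫⁻ x, ENNReal.ofReal (gstar x * F1 x) ≤ ENNReal.ofReal ξ)
    (hs1 : ϑ1 * ((∫⁻ x, ENNReal.ofReal (gstar x * F1 x)).toReal - ξ) = 0)
    (hc2 : ∫⁻ x, ENNReal.ofReal (gstar x * (1 - F1 x)) ≤ ENNReal.ofReal ξ)
    (hs2 : ϑ2 * ((∫⁻ x, ENNReal.ofReal (gstar x * (1 - F1 x))).toReal - ξ) = 0) :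
    ∀ g : ℝ → ℝ, Measurable g → (∀ x, 0 ≤ g x) →
      Integrable (fun x => x * g x * f1 x) →
      (∫ x, x * g x * f1 x) = 1 →
      (∫⁻ x, ENNReal.ofReal (g x * F1 x)) ≤ ENNReal.ofReal ξ →
      (∫⁻ x, ENNReal.ofReal (g x * (1 - F1 x))) ≤ ENNReal.ofReal ξ →
      (∫⁻ x, ENNReal.ofReal (gstar x ^ 2 * f1 x)) ≤ ∫⁻ x, ENNReal.ofReal (g x ^ 2 * f1 x) := by
  intro g hgm hg0 hgi hgn hg1 hg2
  have hfin (x : ℝ) : ∫⁻ t in Set.Iic x, ENNReal.ofReal (f1 t) ≤ 1 :=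
    (setLIntegral_le_lintegral _ _).trans hf1int.le
  have hF0 (x : ℝ) : 0 ≤ F1 x := hF1 x ▸ ENNReal.toReal_nonneg
  have hF1' (x : ℝ) : 0 ≤ 1 - F1 x := by
    rw [sub_nonneg, hF1 x]
    exact ENNReal.toReal_le_of_le_ofReal zero_le_one (by simpa using hfin x)
  have hFm : Measurable F1 := by
    refine Monotone.measurable fun x y hxy => ?_
    rw [hF1 x, hF1 y]
    exact ENNReal.toReal_mono ((hfin y).trans_lt ENNReal.one_lt_top).ne
      (lintegral_mono_set (Set.Iic_subset_Iic.2 hxy))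
  have hsm : Measurable gstar := by
    rw [funext hgstar]
    have hwm : Measurable fun x => ϑ2 + (ϑ1 - ϑ2) * F1 x := by fun_prop
    have hνm : Measurable fun x => ν * x * f1 x := by fun_prop
    exact Measurable.ite
      ((measurableSet_lt measurable_const hf1meas).inter (measurableSet_lt hwm hνm))
      (by fun_prop) measurable_const
  have hs0 (x : ℝ) : 0 ≤ gstar x := truncated_score_nonneg (hgstar x)
  have hw (x : ℝ) : 0 ≤ ϑ2 + (ϑ1 - ϑ2) * F1 x := by
    nlinarith [mul_nonneg hϑ1 (hF0 x), mul_nonneg hϑ2 (hF1' x)]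
  obtain ⟨is1, es1, -⟩ := integrable_and_integral_le_of_lintegral_ofReal_le
    (hsm.mul hFm) (fun x => mul_nonneg (hs0 x) (hF0 x)) hξ.le hc1
  obtain ⟨is2, es2, -⟩ := integrable_and_integral_le_of_lintegral_ofReal_le
    (hsm.mul (hFm.const_sub 1)) (fun x => mul_nonneg (hs0 x) (hF1' x)) hξ.le hc2
  obtain ⟨ig1, -, lg1⟩ := integrable_and_integral_le_of_lintegral_ofReal_le
    (hgm.mul hFm) (fun x => mul_nonneg (hg0 x) (hF0 x)) hξ.le hg1
  obtain ⟨ig2, -, lg2⟩ := integrable_and_integral_le_of_lintegral_ofReal_le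
    (hgm.mul (hFm.const_sub 1)) (fun x => mul_nonneg (hg0 x) (hF1' x)) hξ.le hg2
  simp only [Pi.mul_apply] at es1 es2 lg1 lg2
  rw [← es1] at hs1
  rw [← es2] at hs2
  have hsq0 (x : ℝ) : 0 ≤ gstar x ^ 2 * f1 x := mul_nonneg (sq_nonneg _) (hf1pos x)
  have hgq0 (x : ℝ) : 0 ≤ g x ^ 2 * f1 x := mul_nonneg (sq_nonneg _) (hf1pos x)
  have isq : Integrable fun x => gstar x ^ 2 * f1 x := by
    refine (((hnormint.const_mul ν).sub (is1.const_mul ϑ1)).sub (is2.const_mul ϑ2)).congr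
      (.of_forall fun x => ?_)
    simp only [Pi.sub_apply, Pi.mul_apply]
    rw [truncated_score_sq_mul (hgstar x)]
    ring
  by_cases htop : ∫⁻ x, ENNReal.ofReal (g x ^ 2 * f1 x) = ⊤
  · exact htop ▸ le_top
  have igq : Integrable fun x => g x ^ 2 * f1 x :=
    (lintegral_ofReal_ne_top_iff_integrable (by fun_prop) (.of_forall hgq0)).1 htop
  rw [← ofReal_integral_eq_lintegral_ofReal isq (.of_forall hsq0),
    ← ofReal_integral_eq_lintegral_ofReal igq (.of_forall hgq0)]
  refine ENNReal.ofReal_le_ofReal ?_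
  have iν := (hgi.sub hnormint).const_mul ν
  have i1 := (ig1.sub is1).const_mul ϑ1
  have i2 := (ig2.sub is2).const_mul ϑ2
  have key := integral_mono (isq.add (((iν.sub i1).sub i2).const_mul 2)) igq fun x => by
    have h := truncated_score_tangent_le (hf1pos x) (hw x) (hg0 x) (hgstar x)
    simp only [Pi.add_apply, Pi.sub_apply, Pi.mul_apply]
    linarith
  rw [integral_add' isq (((iν.sub i1).sub i2).const_mul 2), integral_const_mul,
    integral_sub' (iν.sub i1) i2, integral_sub' iν i1, integral_const_mul, integral_const_mul,
    integral_const_mul, integral_sub' hgi hnormint, integral_sub' ig1 is1,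
    integral_sub' ig2 is2, hnorm, hgn] at key
  simp only [Pi.mul_apply] at key
  linarith [mul_le_mul_of_nonneg_left lg1 hϑ1, mul_le_mul_of_nonneg_left lg2 hϑ2]
end

section
/- Let a ∈ ℝ^N satisfy Σ_{n=1}^N a_n = 1. Then √(N·Σ_{n=1}^N a_n²) ≥ 1, and equality holds if and only if a_n = 1/N for all n. Consequently, among L-estimators T_N(x) = Σ_n a_n x_{(n)} with weights a_n = ∫_{(n−1)/N}^{n/N} h(t) dt / ∫_0^1 h(t) dt for some h with ∫_0^1 h(t) dt ≠ 0, the adversarial influence function under the ℓ_2 constraint AIF(T_N, x, 2) = √(N Σ_n a_n²) is minimized, with value 1, exactly when a_n = 1/N for all n, i.e., when T_N is the empirical mean. -/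
/-- For weights summing to one, `N Σ aₙ²` exceeds `1` by `N` times the squared distance to the
uniform weights. -/
theorem card_mul_sum_sq_eq_one_add {N : ℕ} (hN : 0 < N) (a : Fin N → ℝ) (ha : ∑ n, a n = 1) :
    (N : ℝ) * ∑ n, a n ^ 2 = 1 + N * ∑ n, (a n - 1 / (N : ℝ)) ^ 2 := by
  have hN' : (N : ℝ) ≠ 0 := by positivity
  have h : ∑ n, (a n - 1 / (N : ℝ)) ^ 2 = ∑ n, a n ^ 2 - 1 / N := by
    simp only [sub_sq, Finset.sum_add_distrib, Finset.sum_sub_distrib, ← Finset.sum_mul,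
      ← Finset.mul_sum, ha, Finset.sum_const, Finset.card_univ, Fintype.card_fin, nsmul_eq_mul]
    field_simp
    ring
  rw [h]
  field_simp
  ring

theorem one_le_sqrt_card_mul_sum_sq_and_eq_iff {N : ℕ} (hN : 0 < N) (a : Fin N → ℝ)
    (ha : ∑ n, a n = 1) :
    Real.sqrt ((N : ℝ) * ∑ n, a n ^ 2) ≥ 1 ∧
      (Real.sqrt ((N : ℝ) * ∑ n, a n ^ 2) = 1 ↔ ∀ n, a n = 1 / (N : ℝ)) := by
  have hN' : (N : ℝ) ≠ 0 := by positivity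
  have hnonneg : 0 ≤ ∑ n, (a n - 1 / (N : ℝ)) ^ 2 := Finset.sum_nonneg fun n _ => sq_nonneg _
  rw [card_mul_sum_sq_eq_one_add hN a ha]
  refine ⟨Real.one_le_sqrt.2 (le_add_of_nonneg_right (by positivity)), ?_⟩
  rw [Real.sqrt_eq_one, add_eq_left, mul_eq_zero, or_iff_right hN',
    Finset.sum_eq_zero_iff_of_nonneg fun n _ => sq_nonneg _]
  simp [sub_eq_zero]

/-- The integrals over the `N` equal subintervals of `[0, 1]` add up to the whole integral. -/
theorem sum_integral_uniform_partition {N : ℕ} (hN : 0 < N) {h : ℝ → ℝ}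
    (hint : IntervalIntegrable h MeasureTheory.volume 0 1) :
    ∑ n : Fin N, ∫ t in (((n : ℕ) : ℝ) / (N : ℝ))..((((n : ℕ) : ℝ) + 1) / (N : ℝ)), h t =
      ∫ t in (0 : ℝ)..1, h t := by
  have hN' : (0 : ℝ) < N := by positivity
  have hadj := intervalIntegral.sum_integral_adjacent_intervals (f := h)
    (μ := MeasureTheory.volume) (a := fun k : ℕ => (k : ℝ) / N) (n := N) fun k hk => by
      have hk' : ((k + 1 : ℕ) : ℝ) ≤ N := by exact_mod_cast hk
      have hle : (k : ℝ) / N ≤ ((k + 1 : ℕ) : ℝ) / N := by gcongr; simp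
      refine hint.mono_set ?_
      rw [Set.uIcc_of_le hle, Set.uIcc_of_le zero_le_one]
      exact Set.Icc_subset_Icc (by positivity) ((div_le_one hN').2 hk')
  simp only [Nat.cast_add, Nat.cast_one, Nat.cast_zero, zero_div, div_self hN'.ne'] at hadj
  rw [← hadj, Finset.sum_range]

/-- the ℓ₂ AIF `√(N Σ aₙ²)` of an L-estimator with weights summing to 1
is at least 1, with equality iff all weights equal `1/N`; in particular, among
L-estimators generated by a function `h`, it is minimized exactly by the empirical mean. -/
theorem stmt_16 (N : ℕ) (hN : 0 < N) :
    (∀ a : Fin N → ℝ, (∑ n, a n) = 1 →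
      (Real.sqrt ((N : ℝ) * ∑ n, a n ^ 2) ≥ 1 ∧
        (Real.sqrt ((N : ℝ) * ∑ n, a n ^ 2) = 1 ↔ ∀ n, a n = 1 / (N : ℝ)))) ∧
    ∀ h : ℝ → ℝ, (∫ t in (0 : ℝ)..1, h t) ≠ 0 →
      ∀ a : Fin N → ℝ,
        (∀ n : Fin N, a n =
          (∫ t in (((n : ℕ) : ℝ) / (N : ℝ))..((((n : ℕ) : ℝ) + 1) / (N : ℝ)), h t) /
            ∫ t in (0 : ℝ)..1, h t) →
        (Real.sqrt ((N : ℝ) * ∑ n, a n ^ 2) ≥ 1 ∧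
          (Real.sqrt ((N : ℝ) * ∑ n, a n ^ 2) = 1 ↔ ∀ n, a n = 1 / (N : ℝ))) := by
  refine ⟨one_le_sqrt_card_mul_sum_sq_and_eq_iff hN, fun h hne a ha =>
    one_le_sqrt_card_mul_sum_sq_and_eq_iff hN a ?_⟩
  have hint : IntervalIntegrable h MeasureTheory.volume 0 1 :=
    intervalIntegral.intervalIntegrable_of_integral_ne_zero hne
  simp_rw [ha]
  rw [← Finset.sum_div, sum_integral_uniform_partition hN hint, div_self hne]
end

section
/- For every real ξ > 1, the equation e^{−a} = (ξ + 2 − a) / ((ξ + 1)a + ξ + 2) has exactly one solution a in the open interval (0, ∞). -/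
/-- The trimming-threshold equation after multiplication by `e^a` and the denominator reads
`trimGap ξ a = 0`. -/
noncomputable def trimGap (ξ a : ℝ) : ℝ :=
  (ξ + 2 - a) * Real.exp a - ((ξ + 1) * a + ξ + 2)

/-- The first derivative of `trimGap ξ`. -/
noncomputable def trimGapDeriv (ξ a : ℝ) : ℝ :=
  (ξ + 1 - a) * Real.exp a - (ξ + 1)

theorem hasDerivAt_trimGap (ξ a : ℝ) : HasDerivAt (trimGap ξ) (trimGapDeriv ξ a) a := by
  have h := (((hasDerivAt_id a).const_sub (ξ + 2)).mul (Real.hasDerivAt_exp a)).sub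
    ((((hasDerivAt_id a).const_mul (ξ + 1)).add_const ξ).add_const 2)
  refine h.congr_deriv ?_
  simp only [trimGapDeriv, id]
  ring

theorem hasDerivAt_trimGapDeriv (ξ a : ℝ) :
    HasDerivAt (trimGapDeriv ξ) ((ξ - a) * Real.exp a) a := by
  have h := (((hasDerivAt_id a).const_sub (ξ + 1)).mul (Real.hasDerivAt_exp a)).sub_const (ξ + 1)
  refine h.congr_deriv ?_
  simp only [id]
  ring

theorem continuous_trimGap (ξ : ℝ) : Continuous (trimGap ξ) :=
  continuous_iff_continuousAt.2 fun a => (hasDerivAt_trimGap ξ a).continuousAt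

theorem continuous_trimGapDeriv (ξ : ℝ) : Continuous (trimGapDeriv ξ) :=
  continuous_iff_continuousAt.2 fun a => (hasDerivAt_trimGapDeriv ξ a).continuousAt

theorem trimGapDeriv_pos {ξ a : ℝ} (ha : 0 < a) (haξ : a ≤ ξ) : 0 < trimGapDeriv ξ a := by
  have hmono : StrictMonoOn (trimGapDeriv ξ) (Set.Icc 0 ξ) := by
    refine strictMonoOn_of_deriv_pos (convex_Icc 0 ξ) (continuous_trimGapDeriv ξ).continuousOn ?_
    intro x hx
    rw [interior_Icc] at hx
    rw [(hasDerivAt_trimGapDeriv ξ x).deriv]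
    exact mul_pos (sub_pos.2 hx.2) (Real.exp_pos x)
  simpa [trimGapDeriv] using hmono ⟨le_rfl, ha.le.trans haξ⟩ ⟨ha.le, haξ⟩ ha

theorem trimGap_pos {ξ a : ℝ} (ha : 0 < a) (haξ : a ≤ ξ) : 0 < trimGap ξ a := by
  have hmono : StrictMonoOn (trimGap ξ) (Set.Icc 0 ξ) := by
    refine strictMonoOn_of_deriv_pos (convex_Icc 0 ξ) (continuous_trimGap ξ).continuousOn ?_
    intro x hx
    rw [interior_Icc] at hx
    rw [(hasDerivAt_trimGap ξ x).deriv]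
    exact trimGapDeriv_pos hx.1 hx.2.le
  simpa [trimGap] using hmono ⟨le_rfl, ha.le.trans haξ⟩ ⟨ha.le, haξ⟩ ha

theorem concaveOn_trimGap (ξ : ℝ) : ConcaveOn ℝ (Set.Ici ξ) (trimGap ξ) := by
  refine concaveOn_of_hasDerivWithinAt2_nonpos (convex_Ici ξ) (continuous_trimGap ξ).continuousOn
    (fun x _ => (hasDerivAt_trimGap ξ x).hasDerivWithinAt)
    (fun x _ => (hasDerivAt_trimGapDeriv ξ x).hasDerivWithinAt) ?_
  intro x hx
  rw [interior_Ici] at hx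
  exact mul_nonpos_of_nonpos_of_nonneg (sub_nonpos.2 (le_of_lt hx)) (Real.exp_pos x).le

theorem not_lt_of_trimGap_eq_zero {ξ a b : ℝ} (hξ : 0 < ξ) (ha : 0 < a)
    (hga : trimGap ξ a = 0) (hgb : trimGap ξ b = 0) : ¬ a < b := by
  intro hab
  have hξa : ξ < a := by
    by_contra! h
    exact (trimGap_pos ha h).ne' hga
  have hslope := (concaveOn_trimGap ξ).slope_anti_adjacent (Set.mem_Ici.2 le_rfl)
    (Set.mem_Ici.2 (hξa.trans hab).le) hξa hab
  rw [hga, hgb, sub_zero, zero_div, zero_sub] at hslope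
  exact (div_neg_of_neg_of_pos (neg_neg_of_pos (trimGap_pos hξ le_rfl))
    (sub_pos.2 hξa)).not_ge hslope

theorem exp_neg_eq_div_iff_trimGap_eq_zero {ξ a : ℝ} (hξ : 0 < ξ) (ha : 0 < a) :
    Real.exp (-a) = (ξ + 2 - a) / ((ξ + 1) * a + ξ + 2) ↔ trimGap ξ a = 0 := by
  have hden : 0 < (ξ + 1) * a + ξ + 2 := by positivity
  rw [Real.exp_neg, inv_eq_one_div, div_eq_div_iff (Real.exp_pos a).ne' hden.ne', one_mul,
    trimGap, sub_eq_zero, eq_comm]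

/-- for every `ξ > 1`, the trimming-threshold equation
`e^{-a} = (ξ + 2 - a) / ((ξ + 1)a + ξ + 2)` has exactly one solution `a ∈ (0, ∞)`. -/
theorem stmt_18 (ξ : ℝ) (hξ : 1 < ξ) :
    ∃! a : ℝ, a ∈ Set.Ioi (0 : ℝ) ∧
      Real.exp (-a) = (ξ + 2 - a) / ((ξ + 1) * a + ξ + 2) := by
  have hξ0 : 0 < ξ := one_pos.trans hξ
  have hend : trimGap ξ (ξ + 2) ≤ 0 := by
    have : 0 < (ξ + 1) * (ξ + 2) + ξ + 2 := by positivity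
    simp only [trimGap, sub_self, zero_mul, zero_sub]
    linarith
  obtain ⟨a, ⟨hξa, _⟩, hga⟩ := intermediate_value_Icc' (show ξ ≤ ξ + 2 by linarith)
    (continuous_trimGap ξ).continuousOn ⟨hend, (trimGap_pos hξ0 le_rfl).le⟩
  have ha : 0 < a := hξ0.trans_le hξa
  refine ⟨a, ⟨ha, (exp_neg_eq_div_iff_trimGap_eq_zero hξ0 ha).2 hga⟩, ?_⟩
  rintro b ⟨hb, hgb⟩
  rw [exp_neg_eq_div_iff_trimGap_eq_zero hξ0 hb] at hgb
  exact le_antisymm (not_lt.1 (not_lt_of_trimGap_eq_zero hξ0 ha hga hgb))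
    (not_lt.1 (not_lt_of_trimGap_eq_zero hξ0 hb hgb hga))
end
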